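/- Let η, α, β ∈ ℝ, Q ≠ 0, and p₀ ∈ ℝ. Define ρ : ℝ² → ℝ by ρ(x₁, x₂) = p₀ · exp( −(2η/Q) · ( x₂²/2 + α x₁²/2 + β x₁⁴/4 ) ). Then ρ satisfies the stationary Duffing FPKE at every point (x₁, x₂): ∂/∂x₁( ρ · x₂ ) + ∂/∂x₂( ρ · (−η x₂ − α x₁ − β x₁³) ) = (Q/2) · ∂²ρ/∂x₂². -/

import Mathlib

/-- The density p₀ exp(−2ηH/Q) satisfies the stationary Duffing FPKE. -/
theorem duffing_stationary_fpke_solution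
    (η α β Q p₀ : ℝ) (hQ : Q ≠ 0)
    (ρ : ℝ × ℝ → ℝ)
    (hρ : ρ = fun x => p₀ * Real.exp (-(2 * η / Q) *
      (x.2 ^ 2 / 2 + α * x.1 ^ 2 / 2 + β * x.1 ^ 4 / 4)))
    (x₁ x₂ : ℝ) :
    deriv (fun y => ρ (y, x₂) * x₂) x₁
      + deriv (fun y => ρ (x₁, y) * (-η * y - α * x₁ - β * x₁ ^ 3)) x₂
    = Q / 2 * deriv (deriv (fun y => ρ (x₁, y))) x₂ := by
  have h1 : ∀ a b : ℝ, HasDerivAt (fun y => ρ (y, b))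
      (ρ (a, b) * (-(2 * η / Q) * (α * a + β * a ^ 3))) a := by
    intro a b
    subst hρ
    have h := (((((hasDerivAt_pow 2 a).const_mul α).div_const 2).const_add (b ^ 2 / 2)).add
      (((hasDerivAt_pow 4 a).const_mul β).div_const 4)).const_mul (-(2 * η / Q))
    refine (h.exp.const_mul p₀).congr_deriv ?_
    simp only [Pi.add_apply]
    push_cast
    ring
  have h2 : ∀ a b : ℝ, HasDerivAt (fun y => ρ (a, y))
      (ρ (a, b) * (-(2 * η / Q) * b)) b := by
    intro a b
    subst hρ
    have h := (((((hasDerivAt_pow 2 b).div_const 2).add_const (α * a ^ 2 / 2)).add_const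
      (β * a ^ 4 / 4))).const_mul (-(2 * η / Q))
    refine (h.exp.const_mul p₀).congr_deriv ?_
    push_cast
    ring
  have h3 : deriv (fun y => ρ (x₁, y)) = fun y => ρ (x₁, y) * (-(2 * η / Q) * y) :=
    funext fun y => (h2 x₁ y).deriv
  have hf : HasDerivAt (fun y : ℝ => -η * y - α * x₁ - β * x₁ ^ 3) (-η * 1) x₂ :=
    (((hasDerivAt_id' x₂).const_mul (-η)).sub_const _).sub_const _
  have hg : HasDerivAt (fun y : ℝ => -(2 * η / Q) * y) (-(2 * η / Q) * 1) x₂ :=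
    (hasDerivAt_id' x₂).const_mul _
  have e1 := ((h1 x₁ x₂).mul_const x₂).deriv
  have e2 := ((h2 x₁ x₂).fun_mul hf).deriv
  have e3 := ((h2 x₁ x₂).fun_mul hg).deriv
  rw [h3, e1, e2, e3]
  field_simp
  ring
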